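/- arXiv:2605.24118 — 2 statements merged into one kernel-verified Lean document; each statement's English description precedes it below -/
import Mathlib

section
/- Suppose functional data on a finite grid of P points are generated by the true function-on-scalar model: for each grid point p, W(p) = β₀(p) + Σ_{q=1}^{Q} X_q·β_q(p) + Σ_{l=1}^{L} ξ_l·φ_l(p) + ε(p), where on a probability space (Ω, F, ℙ) the covariate vector X : Ω → (Fin Q → ℝ) is integrable, the random-effect scores ξ : Ω → (Fin L → ℝ) are integrable with 𝔼[ξ_l] = 0 for every l, the errors ε : Ω → (Fin P → ℝ) are integrable with 𝔼[ε(p)] = 0 for every p, and the pair (ξ, ε) is independent of X. For a fixed misspecified eigenvector φᴹ : Fin P → ℝ, define the score ξᴹ = Σ_{p} (W(p) − 𝔼[W(p)])·φᴹ(p). Then the conditional expectation of ξᴹ given the σ-algebra generated by X satisfies, almost surely, 𝔼[ξᴹ | σ(X)] = Σ_{q=1}^{Q} (X_q − 𝔼[X_q])·b_q, where b_q = Σ_{p} β_q(p)·φᴹ(p) is the inner product of β_q and φᴹ on the grid. In particular, the regression coefficient of the misspecified score on the q-th covariate equals the projection of the true effect β_q onto the misspecified eigenvector φᴹ. -/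
open MeasureTheory ProbabilityTheory

/-- The regression coefficient of the misspecified PCA score on the q-th covariate
equals the projection of the true effect `β q` onto the misspecified eigenvector `φM`:
the conditional expectation of the score given `σ(X)` is
`∑ q, (X q − 𝔼[X q]) * b q` with `b q = ∑ p, β q p * φM p`. -/
theorem rpcs_condexp_score
    {Ω : Type*} [MeasurableSpace Ω] {μ : Measure Ω} [IsProbabilityMeasure μ]
    (P Q L : ℕ)
    (β0 : Fin P → ℝ) (β : Fin Q → Fin P → ℝ) (φ : Fin L → Fin P → ℝ)
    (φM : Fin P → ℝ)
    (X : Ω → Fin Q → ℝ) (ξ : Ω → Fin L → ℝ) (ε : Ω → Fin P → ℝ)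
    (hXmeas : Measurable X) (hξmeas : Measurable ξ) (hεmeas : Measurable ε)
    (hXint : ∀ q, Integrable (fun ω => X ω q) μ)
    (hξint : ∀ l, Integrable (fun ω => ξ ω l) μ)
    (hξmean : ∀ l, ∫ ω, ξ ω l ∂μ = 0)
    (hεint : ∀ p, Integrable (fun ω => ε ω p) μ)
    (hεmean : ∀ p, ∫ ω, ε ω p ∂μ = 0)
    (hindep : IndepFun (fun ω => (ξ ω, ε ω)) X μ)
    (W : Ω → Fin P → ℝ)
    (hW : ∀ ω p, W ω p =
      β0 p + ∑ q, X ω q * β q p + ∑ l, ξ ω l * φ l p + ε ω p)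
    (ξM : Ω → ℝ)
    (hξM : ∀ ω, ξM ω = ∑ p, (W ω p - ∫ ω', W ω' p ∂μ) * φM p)
    (b : Fin Q → ℝ)
    (hb : ∀ q, b q = ∑ p, β q p * φM p) :
    μ[ξM | MeasurableSpace.comap X inferInstance]
      =ᵐ[μ] fun ω => ∑ q, (X ω q - ∫ ω', X ω' q ∂μ) * b q := by
  have hm : MeasurableSpace.comap X inferInstance ≤ (inferInstance : MeasurableSpace Ω) :=
    hXmeas.comap_le
  have hWm : ∀ p, ∫ ω, W ω p ∂μ = β0 p + ∑ q, (∫ ω, X ω q ∂μ) * β q p := by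
    intro p
    have i1 : Integrable (fun ω => ∑ q, X ω q * β q p) μ :=
      integrable_finsetSum _ fun q _ => (hXint q).mul_const _
    have i2 : Integrable (fun ω => ∑ l, ξ ω l * φ l p) μ :=
      integrable_finsetSum _ fun l _ => (hξint l).mul_const _
    have i0 : Integrable (fun _ : Ω => β0 p) μ := integrable_const _
    have i3 : Integrable (fun ω => β0 p + ∑ q, X ω q * β q p) μ := i0.add i1
    have i4 : Integrable (fun ω => β0 p + ∑ q, X ω q * β q p + ∑ l, ξ ω l * φ l p) μ :=
      i3.add i2
    simp_rw [hW]
    rw [integral_add i4 (hεint p), integral_add i3 i2,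
      integral_add i0 i1, hεmean,
      integral_finsetSum _ fun q _ => (hXint q).mul_const _,
      integral_finsetSum _ fun l _ => (hξint l).mul_const _]
    simp [integral_mul_const, hξmean]
  let h : (Fin L → ℝ) × (Fin P → ℝ) → ℝ := fun z => ∑ p, (∑ l, z.1 l * φ l p + z.2 p) * φM p
  let k : (Fin Q → ℝ) → ℝ := fun x => ∑ q, (x q - ∫ ω', X ω' q ∂μ) * b q
  have hhm : Measurable h := by fun_prop
  have hkm : Measurable k := by fun_prop
  have hin : ∀ p, Integrable (fun ω => (∑ l, ξ ω l * φ l p + ε ω p) * φM p) μ := fun p =>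
    ((integrable_finsetSum _ fun l _ => (hξint l).mul_const _).add (hεint p)).mul_const _
  have hhi : Integrable (fun ω => h (ξ ω, ε ω)) μ := integrable_finsetSum _ fun p _ => hin p
  have hki : Integrable (fun ω => k (X ω)) μ :=
    integrable_finsetSum _ fun q _ => ((hXint q).sub (integrable_const _)).mul_const _
  have hh0 : ∫ ω, h (ξ ω, ε ω) ∂μ = 0 := by
    change ∫ ω, ∑ p, (∑ l, ξ ω l * φ l p + ε ω p) * φM p ∂μ = 0
    rw [integral_finsetSum _ fun p _ => hin p]
    refine Finset.sum_eq_zero fun p _ => ?_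
    rw [integral_mul_const, integral_add
      (integrable_finsetSum _ fun l _ => (hξint l).mul_const _) (hεint p), hεmean,
      integral_finsetSum _ fun l _ => (hξint l).mul_const _]
    simp [integral_mul_const, hξmean]
  have hdec : ξM = (fun ω => k (X ω)) + fun ω => h (ξ ω, ε ω) := by
    funext ω
    have hk : k (X ω) = ∑ p, (∑ q, (X ω q - ∫ ω', X ω' q ∂μ) * β q p) * φM p := by
      simp only [k, hb, Finset.mul_sum, Finset.sum_mul]
      rw [Finset.sum_comm]
      simp only [mul_assoc]
    rw [Pi.add_apply, hk, hξM, ← Finset.sum_add_distrib]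
    refine Finset.sum_congr rfl fun p _ => ?_
    rw [hWm, hW]
    simp only [sub_mul, Finset.sum_sub_distrib]
    ring
  have e1 : μ[fun ω => k (X ω) | MeasurableSpace.comap X inferInstance] = fun ω => k (X ω) :=
    condExp_of_stronglyMeasurable hm
      (hkm.comp (comap_measurable X)).stronglyMeasurable hki
  have e2 : μ[fun ω => h (ξ ω, ε ω) | MeasurableSpace.comap X inferInstance]
      =ᵐ[μ] fun _ => ∫ ω, h (ξ ω, ε ω) ∂μ :=
    condExp_indep_eq (hξmeas.prodMk hεmeas).comap_le hm
      (hhm.comp (comap_measurable (fun ω => (ξ ω, ε ω)))).stronglyMeasurable hindep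
  rw [hdec]
  filter_upwards [condExp_add hki hhi (MeasurableSpace.comap X inferInstance), e2] with ω h1 h2
  rw [h1, Pi.add_apply, h2, e1, hh0, add_zero]
end

section
/- Suppose for each grid point p, W(p) = β₀(p) + Σ_{q=1}^{Q} X_q·β_q(p) + Σ_{l=1}^{L} ξ_l·φ_l(p) + ε(p), where on a probability space (Ω, F, ℙ) the covariate vector X : Ω → (Fin Q → ℝ) is integrable, the scores ξ : Ω → (Fin L → ℝ) are integrable with 𝔼[ξ_l] = 0 for every l, the errors ε : Ω → (Fin P → ℝ) are integrable with 𝔼[ε(p)] = 0 for every p, and the pair (ξ, ε) is independent of X. Fix a misspecified eigenvector φᴹ : Fin P → ℝ and define the score ξᴹ = Σ_{p} (W(p) − 𝔼[W(p)])·φᴹ(p). If for some index q₀ the true effect is orthogonal to φᴹ on the grid, i.e. Σ_{p} β_{q₀}(p)·φᴹ(p) = 0, then almost surely 𝔼[ξᴹ | σ(X)] = Σ_{q ≠ q₀} (X_q − 𝔼[X_q])·(Σ_{p} β_q(p)·φᴹ(p)); in particular the conditional mean of the score does not depend on X_{q₀}, no matter how large the true effect β_{q₀} is. -/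
open MeasureTheory ProbabilityTheory

/-- If the true effect `β q₀` is orthogonal to the misspecified eigenvector `φM`
on the grid, then the conditional mean of the misspecified PCA score given `σ(X)`
does not involve the covariate `X q₀` at all: it equals
`∑_{q ≠ q₀} (X q − 𝔼[X q]) * (∑ p, β q p * φM p)` almost surely. -/
theorem rpcs_no_power_orthogonal
    {Ω : Type*} [MeasurableSpace Ω] {μ : Measure Ω} [IsProbabilityMeasure μ]
    (P Q L : ℕ)
    (β0 : Fin P → ℝ) (β : Fin Q → Fin P → ℝ) (φ : Fin L → Fin P → ℝ)
    (φM : Fin P → ℝ)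
    (X : Ω → Fin Q → ℝ) (ξ : Ω → Fin L → ℝ) (ε : Ω → Fin P → ℝ)
    (hXmeas : Measurable X) (hξmeas : Measurable ξ) (hεmeas : Measurable ε)
    (hXint : ∀ q, Integrable (fun ω => X ω q) μ)
    (hξint : ∀ l, Integrable (fun ω => ξ ω l) μ)
    (hξmean : ∀ l, ∫ ω, ξ ω l ∂μ = 0)
    (hεint : ∀ p, Integrable (fun ω => ε ω p) μ)
    (hεmean : ∀ p, ∫ ω, ε ω p ∂μ = 0)
    (hindep : IndepFun (fun ω => (ξ ω, ε ω)) X μ)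
    (W : Ω → Fin P → ℝ)
    (hW : ∀ ω p, W ω p =
      β0 p + ∑ q, X ω q * β q p + ∑ l, ξ ω l * φ l p + ε ω p)
    (ξM : Ω → ℝ)
    (hξM : ∀ ω, ξM ω = ∑ p, (W ω p - ∫ ω', W ω' p ∂μ) * φM p)
    (q₀ : Fin Q)
    (horth : ∑ p, β q₀ p * φM p = 0) :
    μ[ξM | MeasurableSpace.comap X inferInstance]
      =ᵐ[μ] fun ω => ∑ q ∈ Finset.univ.erase q₀,
        (X ω q - ∫ ω', X ω' q ∂μ) * (∑ p, β q p * φM p) := by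
  have hWint : ∀ p, ∫ ω, W ω p ∂μ = β0 p + ∑ q, (∫ ω, X ω q ∂μ) * β q p := by
    intro p
    have h1 : Integrable (fun ω => ∑ q, X ω q * β q p) μ :=
      integrable_finsetSum _ fun q _ => (hXint q).mul_const _
    have h2 : Integrable (fun ω => ∑ l, ξ ω l * φ l p) μ :=
      integrable_finsetSum _ fun l _ => (hξint l).mul_const _
    have h0 : Integrable (fun _ : Ω => β0 p) μ := integrable_const _
    have h01 : Integrable (fun ω => β0 p + ∑ q, X ω q * β q p) μ := h0.add h1
    have h012 : Integrable (fun ω => β0 p + ∑ q, X ω q * β q p + ∑ l, ξ ω l * φ l p) μ :=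
      h01.add h2
    simp_rw [hW]
    rw [integral_add h012 (hεint p), integral_add h01 h2,
      integral_add h0 h1, integral_finsetSum _ fun q _ => (hXint q).mul_const _,
      integral_finsetSum _ fun l _ => (hξint l).mul_const _]
    simp [integral_mul_const, hξmean, hεmean]
  set A : Ω → ℝ := fun ω => ∑ q ∈ Finset.univ.erase q₀,
        (X ω q - ∫ ω', X ω' q ∂μ) * (∑ p, β q p * φM p) with hA
  let g : (Fin L → ℝ) × (Fin P → ℝ) → ℝ := fun z =>
    ∑ p, (∑ l, z.1 l * φ l p + z.2 p) * φM p
  have hg : Measurable g := by fun_prop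
  let B : Ω → ℝ := fun ω => g (ξ ω, ε ω)
  have hAB : ξM = A + B := by
    funext ω
    have hA' : A ω = ∑ q, (X ω q - ∫ ω', X ω' q ∂μ) * (∑ p, β q p * φM p) := by
      rw [hA]
      exact Finset.sum_erase _ (by rw [horth, mul_zero])
    have hA2 : A ω = ∑ p, (∑ q, (X ω q - ∫ ω', X ω' q ∂μ) * β q p) * φM p := by
      rw [hA']
      simp_rw [Finset.mul_sum, Finset.sum_mul]
      rw [Finset.sum_comm]
      simp_rw [mul_assoc]
    rw [Pi.add_apply, hA2, hξM]
    simp only [B, g]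
    rw [← Finset.sum_add_distrib]
    refine Finset.sum_congr rfl fun p _ => ?_
    rw [hWint, hW]
    simp_rw [sub_mul]
    rw [Finset.sum_sub_distrib]
    ring
  have hAint : Integrable A μ :=
    integrable_finsetSum _ fun q _ => ((hXint q).sub (integrable_const _)).mul_const _
  have hBl : ∀ p, Integrable (fun ω => ∑ l, ξ ω l * φ l p) μ := fun p =>
    integrable_finsetSum _ fun l _ => (hξint l).mul_const _
  have hBint : Integrable B μ :=
    integrable_finsetSum _ fun p _ => ((hBl p).add (hεint p)).mul_const _
  have hB0 : ∫ ω, B ω ∂μ = 0 := by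
    have hBp : ∀ p ∈ (Finset.univ : Finset (Fin P)),
        Integrable (fun ω => (∑ l, ξ ω l * φ l p + ε ω p) * φM p) μ :=
      fun p _ => ((hBl p).add (hεint p)).mul_const _
    simp only [B, g]
    rw [integral_finsetSum _ hBp]
    refine Finset.sum_eq_zero fun p _ => ?_
    rw [integral_mul_const, integral_add (hBl p) (hεint p),
      integral_finsetSum _ fun l _ => (hξint l).mul_const _]
    simp [integral_mul_const, hξmean, hεmean]
  have hm : MeasurableSpace.comap X inferInstance ≤ (inferInstance : MeasurableSpace Ω) :=
    hXmeas.comap_le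
  have hAm : StronglyMeasurable[MeasurableSpace.comap X inferInstance] A := by
    have hf : Measurable (fun x : Fin Q → ℝ => ∑ q ∈ Finset.univ.erase q₀,
        (x q - ∫ ω', X ω' q ∂μ) * (∑ p, β q p * φM p)) := by fun_prop
    exact (hf.comp (comap_measurable X)).stronglyMeasurable
  have hBm : StronglyMeasurable[MeasurableSpace.comap (fun ω => (ξ ω, ε ω)) inferInstance] B :=
    (hg.comp (comap_measurable (fun ω => (ξ ω, ε ω)))).stronglyMeasurable
  have hB := condExp_indep_eq (hξmeas.prodMk hεmeas).comap_le hm hBm hindep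
  rw [hAB]
  filter_upwards [condExp_add hAint hBint (MeasurableSpace.comap X inferInstance), hB]
    with ω h1 h2
  rw [h1, Pi.add_apply, h2, hB0, add_zero, condExp_of_stronglyMeasurable hm hAm hAint]
end
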